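/- For each positive integer n: 1 + ∑_{k=1}^{n} (−q)^k ( O(n, k) + O(n−1, k−1) ) = ∑_{|j| ≤ floor((n+1)/2)} (−1)^j q^{j^2}, where O(a,b) is the generating function in q for overpartitions fitting inside an (a−b)×b rectangle. -/

import Mathlib

open Finset Polynomial

/-- `overp m n k N` is the number of overpartitions of `N` with `k` overlined parts,
largest part `≤ m`, and at most `n` parts. An overpartition is a partition together
with a subset of its (distinct) part sizes which are overlined. -/
noncomputable def overp (m n k N : ℕ) : ℕ :=
  Nat.card {p : Nat.Partition N × Finset ℕ //
    (∀ i ∈ p.1.parts, i ≤ m) ∧ Multiset.card p.1.parts ≤ n ∧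
    p.2 ⊆ p.1.parts.toFinset ∧ p.2.card = k}

/-- The over-(q,t)-binomial coefficient for the `m × n` rectangle, evaluated at
elements `q t` of a commutative ring. -/
noncomputable def Oqt {R : Type*} [CommRing R] (q t : R) (m n : ℕ) : R :=
  ∑ N ∈ range (m * n + 1), ∑ k ∈ range (n + 1), (overp m n k N : R) * t ^ k * q ^ N

/-- The over-(q,1)-binomial coefficient for overpartitions fitting inside an
(a-b) x b rectangle, as a polynomial in q. -/
noncomputable def Oq1 (a b : ℕ) : Polynomial ℤ :=
  ∑ N ∈ range ((a - b) * b + 1),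
    Polynomial.C (∑ k ∈ range (b + 1), (overp (a - b) b k N : ℤ)) * Polynomial.X ^ N

/-- The overpartitions in the `m × n` box, built recursively. -/
def WW : ℕ → ℕ → Finset (Multiset ℕ × Finset ℕ)
  | 0, _ => {(0, ∅)}
  | _ + 1, 0 => {(0, ∅)}
  | m + 1, n + 1 =>
      WW m (n + 1) ∪ ((WW (m + 1) n).image (fun w => ((m + 1) ::ₘ w.1, w.2)) ∪
        (WW m n).image (fun w => ((m + 1) ::ₘ w.1, insert (m + 1) w.2)))

lemma mem_WW_base (s : Multiset ℕ) (t : Finset ℕ) (h : s = 0) :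
    t ⊆ s.toFinset ↔ t = ∅ := by
  subst h; simp

lemma mem_WW (m n : ℕ) : ∀ (s : Multiset ℕ) (t : Finset ℕ), (s, t) ∈ WW m n ↔
    (∀ i ∈ s, 0 < i ∧ i ≤ m) ∧ Multiset.card s ≤ n ∧ t ⊆ s.toFinset := by
  induction m, n using WW.induct with
  | case1 n =>
    intro s t
    simp only [WW, mem_singleton, Prod.mk.injEq]
    constructor
    · rintro ⟨rfl, rfl⟩; simp
    · rintro ⟨h1, h2, h3⟩
      have : s = 0 := Multiset.eq_zero_of_forall_notMem (fun i hi => by have := h1 i hi; omega)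
      exact ⟨this, (mem_WW_base s t this).1 h3⟩
  | case2 m =>
    intro s t
    simp only [WW, mem_singleton, Prod.mk.injEq]
    constructor
    · rintro ⟨rfl, rfl⟩; simp
    · rintro ⟨h1, h2, h3⟩
      have : s = 0 := Multiset.card_eq_zero.1 (by omega)
      exact ⟨this, (mem_WW_base s t this).1 h3⟩
  | case3 m n ih1 ih2 ih3 =>
    intro s t
    simp only [WW, mem_union, mem_image, Prod.exists, Prod.mk.injEq, ih1, ih2, ih3]
    constructor
    · rintro (⟨h1, h2, h3⟩ | ⟨s, t, ⟨h1, h2, h3⟩, rfl, rfl⟩ | ⟨s, t, ⟨h1, h2, h3⟩, rfl, rfl⟩)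
      · exact ⟨fun i hi => by have := h1 i hi; omega, h2, h3⟩
      · refine ⟨?_, by simpa using h2, ?_⟩
        · intro i hi
          rcases Multiset.mem_cons.1 hi with rfl | hi
          · omega
          · exact h1 i hi
        · intro i hi
          have := h3 hi
          simp at this ⊢
          tauto
      · refine ⟨?_, by simpa using h2, ?_⟩
        · intro i hi
          rcases Multiset.mem_cons.1 hi with rfl | hi
          · omega
          · have := h1 i hi; omega
        · intro i hi
          rcases Finset.mem_insert.1 hi with rfl | hi
          · simp
          have := h3 hi
          simp at this ⊢
          tauto
    · rintro ⟨h1, h2, h3⟩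
      by_cases hm : m + 1 ∈ s
      · right
        obtain ⟨s, rfl⟩ := Multiset.exists_cons_of_mem hm
        have hs : ∀ i ∈ s, 0 < i ∧ i ≤ m + 1 := fun i hi => h1 i (Multiset.mem_cons_of_mem hi)
        have hc : Multiset.card s ≤ n := by simpa using h2
        by_cases h : t ⊆ s.toFinset
        · left
          exact ⟨s, t, ⟨hs, hc, h⟩, rfl, rfl⟩
        · right
          have hsub : ∀ i ∈ t, i = m + 1 ∨ i ∈ s := fun i hi => by
            have := h3 hi
            simpa using this
          have hms : m + 1 ∉ s := fun hms => h (fun i hi => by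
            rcases hsub i hi with rfl | h'
            · simpa using hms
            · simpa using h')
          have hmt : m + 1 ∈ t := by
            by_contra hmt
            apply h
            intro i hi
            rcases hsub i hi with rfl | h'
            · exact absurd hi hmt
            · simpa using h'
          refine ⟨s, t.erase (m + 1), ⟨?_, hc, ?_⟩, rfl, Finset.insert_erase hmt⟩
          · intro i hi
            have := hs i hi
            have h' : i ≠ m + 1 := by rintro rfl; exact hms hi
            omega
          · intro i hi
            rw [Finset.mem_erase] at hi
            have := hsub i hi.2
            simp
            tauto
      · left
        refine ⟨fun i hi => ?_, h2, h3⟩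
        have := h1 i hi
        have h' : i ≠ m + 1 := by rintro rfl; exact hm hi
        omega

/-- generating function -/
noncomputable def PP (m n : ℕ) : ℤ[X] := ∑ w ∈ WW m n, X ^ w.1.sum

lemma PP_zero_left (n : ℕ) : PP 0 n = 1 := by simp [PP, WW]

lemma PP_zero_right (m : ℕ) : PP m 0 = 1 := by cases m <;> simp [PP, WW]

lemma PP_rec (m n : ℕ) : PP (m + 1) (n + 1) =
    PP m (n + 1) + X ^ (m + 1) * (PP (m + 1) n + PP m n) := by
  have d1 : Disjoint ((WW (m + 1) n).image (fun w => ((m + 1) ::ₘ w.1, w.2)))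
      ((WW m n).image (fun w => ((m + 1) ::ₘ w.1, insert (m + 1) w.2))) := by
    rw [Finset.disjoint_left]
    rintro ⟨s, t⟩ h1 h2
    simp only [mem_image, Prod.exists, Prod.mk.injEq, mem_WW] at h1 h2
    obtain ⟨s1, t1, ⟨a1, a2, a3⟩, rfl, rfl⟩ := h1
    obtain ⟨s2, t2, ⟨b1, b2, b3⟩, h, rfl⟩ := h2
    have hs : s2 = s1 := (Multiset.cons_inj_right _).1 h
    subst hs
    have := a3 (Finset.mem_insert_self (m + 1) t2)
    have := b1 (m + 1) (by simpa using this)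
    omega
  have d2 : Disjoint (WW m (n + 1)) ((WW (m + 1) n).image (fun w => ((m + 1) ::ₘ w.1, w.2)) ∪
      (WW m n).image (fun w => ((m + 1) ::ₘ w.1, insert (m + 1) w.2))) := by
    rw [Finset.disjoint_left]
    rintro ⟨s, t⟩ h1 h2
    rw [mem_WW] at h1
    have hm : m + 1 ∈ s := by
      simp only [mem_union, mem_image, Prod.exists, Prod.mk.injEq] at h2
      rcases h2 with ⟨s, t, _, rfl, _⟩ | ⟨s, t, _, rfl, _⟩ <;> simp
    have := h1.1 _ hm
    omega
  have i1 : Set.InjOn (fun w : Multiset ℕ × Finset ℕ => ((m + 1) ::ₘ w.1, w.2))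
      (WW (m + 1) n) := by
    rintro ⟨s, t⟩ _ ⟨s', t'⟩ _ h
    simpa using h
  have i2 : Set.InjOn (fun w : Multiset ℕ × Finset ℕ => ((m + 1) ::ₘ w.1, insert (m + 1) w.2))
      (WW m n) := by
    rintro ⟨s, t⟩ h1 ⟨s', t'⟩ h2 h
    simp only [Finset.mem_coe, mem_WW] at h1 h2
    simp only [Prod.mk.injEq, Multiset.cons_inj_right] at h
    have e1 : m + 1 ∉ t := fun h' => by
      have := h1.1 (m + 1) (by simpa using h1.2.2 h'); omega
    have e2 : m + 1 ∉ t' := fun h' => by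
      have := h2.1 (m + 1) (by simpa using h2.2.2 h'); omega
    have := congrArg (fun z => Finset.erase z (m + 1)) h.2
    simp only [Finset.erase_insert e1, Finset.erase_insert e2] at this
    simp [h.1, this]
  unfold PP
  rw [WW, Finset.sum_union d2, Finset.sum_union d1, Finset.sum_image i1, Finset.sum_image i2]
  simp only [Multiset.sum_cons, pow_add, mul_add, Finset.mul_sum]

lemma PP_rec' (m n : ℕ) : PP (m + 1) (n + 1) =
    PP (m + 1) n + X ^ (n + 1) * (PP m (n + 1) + PP m n) := by
  induction m generalizing n with
  | zero =>
    induction n with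
    | zero => rw [PP_rec]; simp [PP_zero_left, PP_zero_right]
    | succ n ih =>
      have h1 := PP_rec 0 (n + 1)
      have h2 := PP_rec 0 n
      simp only [PP_zero_left] at *
      linear_combination h1 - h2 + X * ih
  | succ m ihm =>
    induction n with
    | zero =>
      have h1 := PP_rec (m + 1) 0
      have h2 := PP_rec m 0
      have h3 := ihm 0
      simp only [PP_zero_right] at *
      linear_combination h1 + h3 - X * h2
    | succ n ih =>
      have h1 := PP_rec (m + 1) (n + 1)
      have h2 := PP_rec (m + 1) n
      have h3 := PP_rec m (n + 1)
      have h4 := PP_rec m n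
      have h5 := ihm (n + 1)
      have h6 := ihm n
      linear_combination h1 - h2 + h5 + X ^ (m + 2) * (ih + h6) - X ^ (n + 2) * (h3 + h4)

lemma overp_eq (m n k N : ℕ) : overp m n k N =
    (((WW m n).filter (fun w => w.1.sum = N)).filter (fun w => w.2.card = k)).card := by
  unfold overp
  rw [← Nat.card_eq_finsetCard]
  refine Nat.card_congr ⟨fun p => ⟨(p.1.1.parts, p.1.2), ?_⟩,
    fun w => ⟨(⟨w.1.1, ?_, ?_⟩, w.1.2), ?_⟩, ?_, ?_⟩
  · obtain ⟨⟨p, t⟩, h1, h2, h3, h4⟩ := p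
    simp only [mem_filter, mem_WW]
    exact ⟨⟨⟨fun i hi => ⟨p.parts_pos hi, h1 i hi⟩, h2, h3⟩, p.parts_sum⟩, h4⟩
  · obtain ⟨⟨s, t⟩, h⟩ := w
    simp only [mem_filter, mem_WW] at h
    intro i hi
    exact (h.1.1.1 i hi).1
  · obtain ⟨⟨s, t⟩, h⟩ := w
    simp only [mem_filter, mem_WW] at h
    exact h.1.2
  · obtain ⟨⟨s, t⟩, h⟩ := w
    simp only [mem_filter, mem_WW] at h
    exact ⟨fun i hi => (h.1.1.1 i hi).2, h.1.1.2.1, h.1.1.2.2, h.2⟩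
  · rintro ⟨⟨p, t⟩, h⟩
    rfl
  · rintro ⟨⟨s, t⟩, h⟩
    rfl

lemma Oq1_eq (a b : ℕ) : Oq1 a b = PP (a - b) b := by
  unfold Oq1 PP
  rw [← Finset.sum_fiberwise_of_maps_to (s := WW (a - b) b) (t := range ((a - b) * b + 1))
    (g := fun w => w.1.sum)]
  · apply Finset.sum_congr rfl
    intro N _
    have h2 : ∀ w ∈ (WW (a - b) b).filter (fun w => w.1.sum = N), w.2.card ∈ range (b + 1) := by
      rintro ⟨s, t⟩ h
      rw [mem_filter, mem_WW] at h
      have e1 := Finset.card_le_card h.1.2.2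
      have e2 := Multiset.toFinset_card_le s
      simp only [mem_range]
      omega
    rw [Finset.sum_congr rfl (g := fun _ => (X : ℤ[X]) ^ N)
      (fun w hw => by rw [(mem_filter.1 hw).2]), Finset.sum_const,
      Finset.card_eq_sum_card_fiberwise h2]
    simp [overp_eq]
  · rintro ⟨s, t⟩ h
    rw [mem_WW] at h
    have := Multiset.sum_le_card_nsmul s (a - b) (fun i hi => (h.1 i hi).2)
    have h3 : Multiset.card s * (a - b) ≤ b * (a - b) := Nat.mul_le_mul_right _ h.2.1
    simp only [mem_range, smul_eq_mul] at *
    rw [mul_comm (a - b) b]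
    omega

/-- alternating sums -/
noncomputable def AA (n : ℕ) : ℤ[X] := ∑ x ∈ antidiagonal n, (-1) ^ x.2 * PP x.1 x.2

/-- alternating weighted sums -/
noncomputable def BB (n : ℕ) : ℤ[X] := ∑ x ∈ antidiagonal n, (-X) ^ x.2 * PP x.1 x.2

lemma anti_both (f : ℕ × ℕ → ℤ[X]) (n : ℕ) : ∑ x ∈ antidiagonal (n + 2), f x =
    f (n + 2, 0) + f (0, n + 2) + ∑ x ∈ antidiagonal n, f (x.1 + 1, x.2 + 1) := by
  rw [Finset.Nat.sum_antidiagonal_succ, Finset.Nat.sum_antidiagonal_succ']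
  ring

lemma BB_rec (n : ℕ) : BB (n + 2) = BB (n + 1) - X ^ (n + 2) * (AA (n + 1) + AA n) := by
  have e1 : BB (n + 1) = 1 + ∑ x ∈ antidiagonal n, (-X) ^ (x.2 + 1) * PP x.1 (x.2 + 1) := by
    rw [BB, Finset.Nat.sum_antidiagonal_succ']
    simp [PP_zero_right]
  have e2 : AA (n + 1) = (-1) ^ (n + 1) +
      ∑ x ∈ antidiagonal n, (-1) ^ x.2 * PP (x.1 + 1) x.2 := by
    rw [AA, Finset.Nat.sum_antidiagonal_succ]
    simp [PP_zero_left]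
  have e3 : BB (n + 2) = 1 + (-X) ^ (n + 2) +
      ∑ x ∈ antidiagonal n, (-X) ^ (x.2 + 1) * PP (x.1 + 1) (x.2 + 1) := by
    rw [BB, anti_both]
    simp [PP_zero_left, PP_zero_right]
  have e4 : ∑ x ∈ antidiagonal n, (-X : ℤ[X]) ^ (x.2 + 1) * PP (x.1 + 1) (x.2 + 1) =
      ∑ x ∈ antidiagonal n, (-X) ^ (x.2 + 1) * PP x.1 (x.2 + 1) - X ^ (n + 2) *
      (∑ x ∈ antidiagonal n, (-1) ^ x.2 * PP (x.1 + 1) x.2 + AA n) := by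
    rw [AA, ← Finset.sum_add_distrib, Finset.mul_sum, ← Finset.sum_sub_distrib]
    apply Finset.sum_congr rfl
    rintro ⟨m, k⟩ h
    rw [Finset.HasAntidiagonal.mem_antidiagonal] at h
    simp only at h ⊢
    subst h
    rw [PP_rec, neg_pow]
    ring
  rw [e3, e4, e1, e2, neg_pow]
  ring

lemma AA_rec (n : ℕ) : AA (n + 2) + AA (n + 1) = BB (n + 1) - X * BB n := by
  have e1 : BB (n + 1) = 1 + ∑ x ∈ antidiagonal n, (-X) ^ (x.2 + 1) * PP x.1 (x.2 + 1) := by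
    rw [BB, Finset.Nat.sum_antidiagonal_succ']
    simp [PP_zero_right]
  have e2 : AA (n + 1) = (-1) ^ (n + 1) +
      ∑ x ∈ antidiagonal n, (-1) ^ x.2 * PP (x.1 + 1) x.2 := by
    rw [AA, Finset.Nat.sum_antidiagonal_succ]
    simp [PP_zero_left]
  have e3 : AA (n + 2) = 1 + (-1) ^ (n + 2) +
      ∑ x ∈ antidiagonal n, (-1) ^ (x.2 + 1) * PP (x.1 + 1) (x.2 + 1) := by
    rw [AA, anti_both]
    simp [PP_zero_left, PP_zero_right]
  have e4 : ∑ x ∈ antidiagonal n, (-1 : ℤ[X]) ^ (x.2 + 1) * PP (x.1 + 1) (x.2 + 1) =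
      ∑ x ∈ antidiagonal n, (-X) ^ (x.2 + 1) * PP x.1 (x.2 + 1)
      - ∑ x ∈ antidiagonal n, (-1) ^ x.2 * PP (x.1 + 1) x.2 - X * BB n := by
    rw [BB, Finset.mul_sum, ← Finset.sum_sub_distrib, ← Finset.sum_sub_distrib]
    apply Finset.sum_congr rfl
    rintro ⟨m, k⟩ h
    simp only
    rw [PP_rec', neg_pow (X : ℤ[X]), neg_pow (X : ℤ[X]) k]
    ring
  rw [e3, e4, e1, e2]
  ring

/-- left side -/
noncomputable def UU (n : ℕ) : ℤ[X] := BB (n + 1) - X * BB n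

lemma UU_rec (n : ℕ) : UU (n + 3) - UU (n + 2) = - X ^ (n + 4) * (UU (n + 1) - UU n) := by
  have h1 := BB_rec (n + 2)
  have h2 := BB_rec (n + 1)
  rw [AA_rec] at h1 h2
  simp only [UU]
  linear_combination h1 - X * h2

lemma BB0 : BB 0 = 1 := by simp [BB, PP_zero_left]
lemma BB1 : BB 1 = 1 - X := by
  simp [BB, Finset.Nat.sum_antidiagonal_succ, PP_zero_left, PP_zero_right]; ring
lemma AA0 : AA 0 = 1 := by simp [AA, PP_zero_left]
lemma AA1 : AA 1 = 0 := by
  simp [AA, Finset.Nat.sum_antidiagonal_succ, PP_zero_left, PP_zero_right]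

lemma UU_diff (m : ℕ) : UU (2 * m + 1) - UU (2 * m) = 0 ∧
    UU (2 * m + 2) - UU (2 * m + 1) = 2 * (-1) ^ m * X ^ ((m + 2) ^ 2) := by
  induction m with
  | zero =>
    have h1 := BB_rec 0
    have h2 := BB_rec 1
    rw [AA_rec] at h2
    simp only [zero_add, AA0, AA1, BB0, BB1] at h1 h2
    simp only [UU, mul_zero, zero_add, BB0, BB1]
    norm_num at *
    constructor
    · rw [h1]; ring
    · rw [h2, h1]; ring
  | succ m ih =>
    have h1 := UU_rec (2 * m)
    have h2 := UU_rec (2 * m + 1)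
    rw [ih.1] at h1
    rw [show 2 * m + 1 + 1 = 2 * m + 2 by ring, ih.2] at h2
    constructor
    · rw [show 2 * (m + 1) + 1 = 2 * m + 3 by ring, show 2 * (m + 1) = 2 * m + 2 by ring, h1]
      ring
    · rw [show 2 * (m + 1) + 1 = 2 * m + 3 by ring, show 2 * (m + 1) + 2 = 2 * m + 1 + 3 by ring,
        show 2 * m + 3 = 2 * m + 1 + 2 by ring, h2]
      ring

/-- right side -/
noncomputable def TT (r : ℕ) : ℤ[X] :=
  ∑ j ∈ Finset.Icc (-(r : ℤ)) (r : ℤ), (-1 : ℤ[X]) ^ j.natAbs * X ^ (j.natAbs ^ 2)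

lemma TT_succ (r : ℕ) : TT (r + 1) = TT r + 2 * (-1) ^ (r + 1) * X ^ ((r + 1) ^ 2) := by
  have h : Finset.Icc (-((r + 1 : ℕ) : ℤ)) ((r + 1 : ℕ) : ℤ) =
      insert (-((r + 1 : ℕ) : ℤ)) (insert ((r + 1 : ℕ) : ℤ) (Finset.Icc (-(r : ℤ)) (r : ℤ))) := by
    ext j
    simp only [Finset.mem_Icc, Finset.mem_insert]
    omega
  rw [TT, h, Finset.sum_insert, Finset.sum_insert, ← TT, Int.natAbs_neg, Int.natAbs_natCast]
  · ring
  · simp only [Finset.mem_Icc]; omega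
  · simp only [Finset.mem_Icc, Finset.mem_insert]; omega

lemma UU_eq (m : ℕ) : UU (2 * m) = TT (m + 1) ∧ UU (2 * m + 1) = TT (m + 1) := by
  induction m with
  | zero =>
    have h0 : UU 0 = TT 1 := by
      rw [show (1 : ℕ) = 0 + 1 from rfl, TT_succ, UU]
      simp [BB0, BB1, TT]
      ring
    have := UU_diff 0
    refine ⟨h0, ?_⟩
    rw [sub_eq_zero.1 this.1]; exact h0
  | succ m ih =>
    have h1 := (UU_diff m).2
    have h2 := (UU_diff (m + 1)).1
    have h3 : UU (2 * (m + 1)) = TT (m + 1 + 1) := by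
      rw [TT_succ (m + 1), ← ih.2, show 2 * (m + 1) = 2 * m + 2 by ring]
      linear_combination h1
    exact ⟨h3, by rw [sub_eq_zero.1 h2, h3]⟩

lemma UU_eq' (n : ℕ) : UU n = TT ((n + 2) / 2) := by
  rcases Nat.even_or_odd' n with ⟨m, rfl | rfl⟩
  · rw [(UU_eq m).1]; congr 1; omega
  · rw [(UU_eq m).2]; congr 1; omega

theorem stmt10 (n : ℕ) (hn : 0 < n) :
    1 + ∑ k ∈ Icc 1 n, (-(Polynomial.X : Polynomial ℤ)) ^ k * (Oq1 n k + Oq1 (n - 1) (k - 1)) =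
      ∑ j ∈ Finset.Icc (-(((n + 1) / 2 : ℕ) : ℤ)) (((n + 1) / 2 : ℕ) : ℤ),
        (-1 : Polynomial ℤ) ^ j.natAbs * Polynomial.X ^ (j.natAbs ^ 2) := by
  obtain ⟨n, rfl⟩ : ∃ l, n = l + 1 := ⟨n - 1, by omega⟩
  have h := UU_eq' n
  rw [TT] at h
  rw [show n + 1 + 1 = n + 2 from rfl, ← h, UU]
  have key : ∀ (l : ℕ) (f : ℕ × ℕ → ℤ[X]),
      ∑ x ∈ antidiagonal l, f x = ∑ k ∈ range (l + 1), f (l - k, k) := by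
    intro l f
    rw [← Finset.Nat.sum_antidiagonal_swap, Finset.Nat.sum_antidiagonal_eq_sum_range_succ_mk]
    rfl
  have e1 : BB (n + 1) = 1 + ∑ k ∈ range (n + 1), (-X) ^ (k + 1) * PP (n - k) (k + 1) := by
    rw [BB, Finset.Nat.sum_antidiagonal_succ', key]
    simp [PP_zero_right]
  have e2 : BB n = ∑ k ∈ range (n + 1), (-X) ^ k * PP (n - k) k := by
    rw [BB, key]
  have e3 : ∀ f : ℕ → ℤ[X], ∑ k ∈ Icc 1 (n + 1), f k = ∑ k ∈ range (n + 1), f (k + 1) := by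
    intro f
    rw [Finset.range_eq_Ico, Finset.sum_Ico_add' f 0 (n + 1) 1]
    rfl
  rw [e1, e2, e3, Finset.mul_sum, add_sub_assoc, ← Finset.sum_sub_distrib]
  congr 1
  apply Finset.sum_congr rfl
  intro k _
  simp only [Oq1_eq, Nat.add_sub_cancel, Nat.add_sub_add_right]
  ring
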